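/- Let U be a utility function with lim_{x→∞} U(x) < +∞, let L be a loss function with lim_{x→−∞} L(x) = −∞ and AE₋(L) := limsup_{x→∞} (−x L'(−x))/L(−x) < 1, and let λ > 0. Define W_λ(x) := U(x) − λ L(−x). Then limsup_{x→∞} x W_λ'(x)/W_λ(x) ≤ AE₋(L) < 1. -/

import Mathlib

structure IsUtility (U U' : ℝ → ℝ) : Prop where
  strictMono : StrictMonoOn U (Set.Ioi 0)
  strictConcave : StrictConcaveOn ℝ (Set.Ioi 0) U
  hasDeriv : ∀ x ∈ Set.Ioi (0:ℝ), HasDerivAt U (U' x) x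
  contDeriv : ContinuousOn U' (Set.Ioi 0)
  inada_top : Filter.Tendsto U' Filter.atTop (nhds 0)
  inada_zero : Filter.Tendsto U' (nhdsWithin 0 (Set.Ioi 0)) Filter.atTop

structure IsLoss (L L' : ℝ → ℝ) : Prop where
  strictMono : StrictMonoOn L (Set.Iio 0)
  strictConvex : StrictConvexOn ℝ (Set.Iio 0) L
  hasDeriv : ∀ x ∈ Set.Iio (0:ℝ), HasDerivAt L (L' x) x
  contDeriv : ContinuousOn L' (Set.Iio 0)
  derivLimAtZero : ∃ c : ℝ, Filter.Tendsto L' (nhdsWithin 0 (Set.Iio 0)) (nhds c)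
  derivLimAtBot : Filter.Tendsto L' Filter.atBot (nhds 0)


open Filter Topology

/-- For a concave function on the positive half-line, `x * f' x` is controlled by an increment. -/
theorem mul_deriv_le_two_mul_sub_half {f : ℝ → ℝ} {f' x : ℝ}
    (hf : ConcaveOn ℝ (Set.Ioi 0) f) (hx : 0 < x) (hd : HasDerivAt f f' x) :
    x * f' ≤ 2 * (f x - f (x / 2)) := by
  have h := hf.le_slope_of_hasDerivAt (x := x / 2) (y := x) (by simpa using hx) hx
    (by linarith) hd
  rw [slope_def_field, le_div_iff₀ (by linarith)] at h
  linarith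

/-- Adding a bounded convergent term to a divergent denominator does not change the ratio. -/
theorem tendsto_div_add_of_tendsto_atTop {α : Type*} {l : Filter α} {u g : α → ℝ} {c : ℝ}
    (hu : Tendsto u l (𝓝 c)) (hg : Tendsto g l atTop) :
    Tendsto (fun x => g x / (u x + g x)) l (𝓝 1) := by
  have hd : Tendsto (fun x => u x + g x) l atTop := hu.add_atTop hg
  have h : Tendsto (fun x => 1 - u x / (u x + g x)) l (𝓝 (1 - 0)) :=
    tendsto_const_nhds.sub (hu.div_atTop hd)
  rw [sub_zero] at h
  refine h.congr' ?_
  filter_upwards [hd.eventually_gt_atTop 0] with x hx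
  rw [eq_div_iff hx.ne', sub_mul, div_mul_cancel₀ _ hx.ne']
  ring

/-- If `U` has a finite limit at `+infinity` and `L → -infinity` with `AE₋ L < 1`, then
the asymptotic elasticity of `W_lam` is at most `AE₋ L < 1`. -/
theorem ae_W_le_aeL (U U' L L' : ℝ → ℝ) (hU : IsUtility U U') (hL : IsLoss L L')
    (cU : ℝ) (hUlim : Filter.Tendsto U Filter.atTop (nhds cU))
    (hLlim : Filter.Tendsto L Filter.atBot Filter.atBot)
    (hAEL : Filter.limsup (fun x : ℝ => ((-x * L' (-x) / L (-x) : ℝ) : EReal))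
      Filter.atTop < 1)
    (lam : ℝ) (hlam : 0 < lam) :
    Filter.limsup
        (fun x : ℝ => ((x * (U' x + lam * L' (-x)) / (U x - lam * L (-x)) : ℝ) : EReal))
        Filter.atTop
      ≤ Filter.limsup (fun x : ℝ => ((-x * L' (-x) / L (-x) : ℝ) : EReal)) Filter.atTop ∧
    Filter.limsup (fun x : ℝ => ((-x * L' (-x) / L (-x) : ℝ) : EReal)) Filter.atTop < 1 := by
  refine ⟨le_of_forall_gt_imp_ge_of_dense fun c hc => ?_, hAEL⟩
  obtain ⟨b, hab, hbc⟩ := EReal.lt_iff_exists_real_btwn.1 hc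
  obtain ⟨b', hab', hbb'⟩ := EReal.lt_iff_exists_real_btwn.1 hab
  have hb : b' < b := EReal.coe_lt_coe_iff.1 hbb'
  have hLneg : Tendsto (fun x => L (-x)) atTop atBot := hLlim.comp tendsto_neg_atTop_atBot
  have hG : Tendsto (fun x => -(lam * L (-x))) atTop atTop :=
    tendsto_neg_atBot_atTop.comp (hLneg.const_mul_atBot hlam)
  have hD : Tendsto (fun x => U x + -(lam * L (-x))) atTop atTop := hUlim.add_atTop hG
  have hhalf : Tendsto (fun x => U (x / 2)) atTop (𝓝 cU) :=
    hUlim.comp (tendsto_id.atTop_div_const two_pos)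
  have hnull : Tendsto (fun x => 2 * (U x - U (x / 2)) / (U x + -(lam * L (-x)))) atTop (𝓝 0) :=
    ((hUlim.sub hhalf).const_mul 2).div_atTop hD
  have hlim : Tendsto (fun x => 2 * (U x - U (x / 2)) / (U x + -(lam * L (-x)))
      + b' * (-(lam * L (-x)) / (U x + -(lam * L (-x))))) atTop (𝓝 (0 + b' * 1)) :=
    hnull.add ((tendsto_div_add_of_tendsto_atTop hUlim hG).const_mul b')
  rw [zero_add, mul_one] at hlim
  refine le_trans (limsup_le_of_le (a := (b : EReal)) (by isBoundedDefault) ?_) hbc.le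
  filter_upwards [hlim.eventually_lt_const hb, eventually_lt_of_limsup_lt hab',
    hLneg.eventually_lt_atBot 0, hD.eventually_gt_atTop 0, eventually_gt_atTop 0]
    with x hxb hr hL0 hD0 hx0
  rw [EReal.coe_lt_coe_iff, div_lt_iff_of_neg hL0] at hr
  rw [EReal.coe_le_coe_iff]
  refine le_trans ?_ hxb.le
  rw [← mul_div_assoc, ← add_div, ← sub_eq_add_neg]
  rw [← sub_eq_add_neg] at hD0
  refine div_le_div_of_nonneg_right ?_ hD0.le
  have hU1 := mul_deriv_le_two_mul_sub_half hU.strictConcave.concaveOn hx0 (hU.hasDeriv x hx0)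
  have hL1 := mul_lt_mul_of_pos_left hr hlam
  linarith
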